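/- Let E₁, E₂ ∈ (𝓜, c_k, n_k, κ) and let f ∈ C³(ℝ²). Suppose there exists p ≥ 1 such that f satisfies the sign condition on C_p × D_p with associated sign δ ∈ {1, −1}, where C_p and D_p are the unions of the level-p basic intervals of E₁ and E₂ respectively, and for every (x,y) ∈ C_p × D_p and every k ≥ p: (c_k∂_x + δ(ξ_k − 1)∂_y)²f(x,y) ≥ 0, (∂_y + δ(ξ_k − 1)∂_x)²f(x,y) ≥ 0, and 1 − ξ_k ≤ δ·∂_y f(x,y)/∂_x f(x,y) ≤ c_k/(1 − ξ_k). Then f(E₁, E₂) = {f(x,y) : x ∈ E₁, y ∈ E₂} is a union of finitely many closed intervals. -/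

import Mathlib

/-- First-order partial derivative in `x` of `f : ℝ² → ℝ`. -/
noncomputable def pdx (f : ℝ × ℝ → ℝ) (p : ℝ × ℝ) : ℝ := fderiv ℝ f p (1, 0)

/-- First-order partial derivative in `y` of `f : ℝ² → ℝ`. -/
noncomputable def pdy (f : ℝ × ℝ → ℝ) (p : ℝ × ℝ) : ℝ := fderiv ℝ f p (0, 1)

/-- Second-order partial derivative `∂_{xx} f`. -/
noncomputable def pdxx (f : ℝ × ℝ → ℝ) (p : ℝ × ℝ) : ℝ := fderiv ℝ (pdx f) p (1, 0)

/-- Second-order partial derivative `∂_{xy} f`. -/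
noncomputable def pdxy (f : ℝ × ℝ → ℝ) (p : ℝ × ℝ) : ℝ := fderiv ℝ (pdx f) p (0, 1)

/-- Second-order partial derivative `∂_{yy} f`. -/
noncomputable def pdyy (f : ℝ × ℝ → ℝ) (p : ℝ × ℝ) : ℝ := fderiv ℝ (pdy f) p (0, 1)

/-- `(ℓ₁∂_x + ℓ₂∂_y)² f = ℓ₁²∂_{xx}f + 2ℓ₁ℓ₂∂_{xy}f + ℓ₂²∂_{yy}f`. -/
noncomputable def quadOp (l₁ l₂ : ℝ) (f : ℝ × ℝ → ℝ) (p : ℝ × ℝ) : ℝ :=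
  l₁ ^ 2 * pdxx f p + 2 * l₁ * l₂ * pdxy f p + l₂ ^ 2 * pdyy f p

/-- `f` satisfies the sign condition on `S` with sign `δ`: both partial derivatives are
nowhere zero with constant sign on `S`; `δ = 1` if the signs agree, `δ = -1` otherwise. -/
def SignCond (f : ℝ × ℝ → ℝ) (S : Set (ℝ × ℝ)) (δ : ℝ) : Prop :=
  (δ = 1 ∧ ((∀ p ∈ S, 0 < pdx f p ∧ 0 < pdy f p) ∨ (∀ p ∈ S, pdx f p < 0 ∧ pdy f p < 0))) ∨
  (δ = -1 ∧ ((∀ p ∈ S, pdx f p < 0 ∧ 0 < pdy f p) ∨ (∀ p ∈ S, 0 < pdx f p ∧ pdy f p < 0)))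

/-- The common length `c₁ ⋯ c_k` of the level-`k` basic intervals. -/
noncomputable def moranLen (c : ℕ → ℝ) (k : ℕ) : ℝ := ∏ j ∈ Finset.range k, c (j + 1)

/-- A word `w = (i₁, …, i_k)` is admissible if `i_j < n j` for all `j`
(children at level `j` are indexed by `0, …, n j - 1`). -/
def MoranAdm (n : ℕ → ℕ) (w : List ℕ) : Prop := ∀ i < w.length, w.getD i 0 < n (i + 1)

/-- The union `C_k` of all level-`k` basic intervals, where `L w` is the left endpoint of
the basic interval coded by the word `w`. -/
def moranLevel (c : ℕ → ℝ) (n : ℕ → ℕ) (L : List ℕ → ℝ) (k : ℕ) : Set ℝ :=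
  ⋃ w ∈ {w : List ℕ | MoranAdm n w ∧ w.length = k}, Set.Icc (L w) (L w + moranLen c k)

/-- `E` is a homogeneous Moran set of the class `(𝓜, c_k, n_k, κ)`, witnessed by the
left-endpoint function `L` of its basic intervals: the level-0 interval is `[0,1]`; each
level-`k` basic interval `I = [L w, L w + c₁⋯c_k]` contains the `n_{k+1}` level-`(k+1)`
basic intervals `I_0, …, I_{n_{k+1}-1}` of length `c₁⋯c_{k+1}`, listed from left to right,
whose union is a proper subset of `I`, with `I_0` sharing the left endpoint of `I`,
`I_{n_{k+1}-1}` sharing the right endpoint of `I`, and `|I_i ∩ I_j| ≤ κ·c₁⋯c_{k+1}` for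
`i < j`; and `E = ⋂_k C_k`. -/
def IsMoran (c : ℕ → ℝ) (n : ℕ → ℕ) (κ : ℝ) (L : List ℕ → ℝ) (E : Set ℝ) : Prop :=
  L [] = 0 ∧
  (∀ w : List ℕ, MoranAdm n w →
    (∀ i j : ℕ, i < j → j < n (w.length + 1) →
      L (w ++ [i]) ≤ L (w ++ [j]) ∧
      L (w ++ [i]) + moranLen c (w.length + 1) - L (w ++ [j]) ≤
        κ * moranLen c (w.length + 1)) ∧
    L (w ++ [0]) = L w ∧
    L (w ++ [n (w.length + 1) - 1]) + moranLen c (w.length + 1) =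
      L w + moranLen c w.length ∧
    (⋃ i ∈ Finset.range (n (w.length + 1)),
        Set.Icc (L (w ++ [i])) (L (w ++ [i]) + moranLen c (w.length + 1)))
      ⊂ Set.Icc (L w) (L w + moranLen c w.length)) ∧
  E = ⋂ k, moranLevel c n L k

/-- `ξ_k = c_k (2 + (n_k − 2)(1 − κ))`. -/
noncomputable def xiM (c : ℕ → ℝ) (n : ℕ → ℕ) (κ : ℝ) (k : ℕ) : ℝ :=
  c k * (2 + ((n k : ℝ) - 2) * (1 - κ))

open Set in
lemma mvt_rect (f : ℝ × ℝ → ℝ) (hf : Differentiable ℝ f) (s : Set (ℝ × ℝ)) (hs : Convex ℝ s)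
    (P Q : ℝ × ℝ) (hP : P ∈ s) (hQ : Q ∈ s) :
    ∃ z ∈ s, f Q - f P = (Q.1 - P.1) * pdx f z + (Q.2 - P.2) * pdy f z := by
  obtain ⟨z, hz, h⟩ := domain_mvt (f := f) (s := s) (f' := fun z => fderiv ℝ f z)
    (fun x _ => (hf x).hasFDerivAt.hasFDerivWithinAt) hs hP hQ
  refine ⟨z, hs.segment_subset hP hQ hz, ?_⟩
  rw [h]
  have : Q - P = (Q.1 - P.1) • ((1 : ℝ), (0 : ℝ)) + (Q.2 - P.2) • ((0 : ℝ), (1 : ℝ)) := by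
    ext <;> simp
  rw [this, map_add, map_smul, map_smul]
  rfl

lemma pdx_neg (f : ℝ × ℝ → ℝ) (q : ℝ × ℝ) : pdx (-f) q = - pdx f q := by
  simp [pdx, fderiv_neg]

lemma pdy_neg (f : ℝ × ℝ → ℝ) (q : ℝ × ℝ) : pdy (-f) q = - pdy f q := by
  simp [pdy, fderiv_neg]

lemma fderiv_swap (f : ℝ × ℝ → ℝ) (hf : Differentiable ℝ f) (q v : ℝ × ℝ) :
    fderiv ℝ (f ∘ Prod.swap) q v = fderiv ℝ f q.swap v.swap := by
  have h : HasFDerivAt (Prod.swap : ℝ × ℝ → ℝ × ℝ)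
      ((ContinuousLinearEquiv.prodComm ℝ ℝ ℝ : ℝ × ℝ →L[ℝ] ℝ × ℝ)) q :=
    (ContinuousLinearEquiv.prodComm ℝ ℝ ℝ : ℝ × ℝ →L[ℝ] ℝ × ℝ).hasFDerivAt
  rw [((hf q.swap).hasFDerivAt.comp q h).fderiv]
  rfl

lemma pdx_swap (f : ℝ × ℝ → ℝ) (hf : Differentiable ℝ f) (q : ℝ × ℝ) :
    pdx (f ∘ Prod.swap) q = pdy f q.swap := fderiv_swap f hf q _

lemma pdy_swap (f : ℝ × ℝ → ℝ) (hf : Differentiable ℝ f) (q : ℝ × ℝ) :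
    pdy (f ∘ Prod.swap) q = pdx f q.swap := fderiv_swap f hf q _

open Set in
lemma gap_pos (f : ℝ × ℝ → ℝ) (hf : Differentiable ℝ f) (u h v v' : ℝ) (hh : 0 ≤ h)
    (hv : v ≤ v')
    (H : ∀ q ∈ Icc u (u + h) ×ˢ Icc v v', |pdy f q| * (v' - v) ≤ pdx f q * h) :
    ∃ s ∈ Icc u (u + h), ∃ t ∈ Icc u (u + h), f (s, v) = f (t, v') := by
  have hconv : Convex ℝ (Icc u (u + h) ×ˢ Icc v v') := (convex_Icc _ _).prod (convex_Icc _ _)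
  have hc := hf.continuous
  have key : ∀ z ∈ Icc u (u + h) ×ˢ Icc v v',
      0 ≤ h * pdx f z + (v' - v) * pdy f z ∧ 0 ≤ h * pdx f z - (v' - v) * pdy f z := by
    intro z hz
    have h1 := H z hz
    have h2 := mul_le_mul_of_nonneg_right (le_abs_self (pdy f z)) (sub_nonneg.2 hv)
    have h3 := mul_le_mul_of_nonneg_right (neg_abs_le (pdy f z)) (sub_nonneg.2 hv)
    constructor <;> nlinarith
  obtain ⟨z1, hz1, e1⟩ := mvt_rect f hf _ hconv (u, v) (u + h, v')
    ⟨⟨le_rfl, by simpa using hh⟩, ⟨le_rfl, hv⟩⟩ ⟨⟨by simpa using hh, le_rfl⟩, ⟨hv, le_rfl⟩⟩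
  obtain ⟨z2, hz2, e2⟩ := mvt_rect f hf _ hconv (u, v') (u + h, v)
    ⟨⟨le_rfl, by simpa using hh⟩, ⟨hv, le_rfl⟩⟩ ⟨⟨by simpa using hh, le_rfl⟩, ⟨le_rfl, hv⟩⟩
  have k1 := (key z1 hz1).1
  have k2 := (key z2 hz2).2
  simp only at e1 e2
  have hG : ContinuousOn (fun t : ℝ => f (u + t * h, v) - f (u + (1 - t) * h, v')) (Icc 0 1) := by
    fun_prop
  have hI := intermediate_value_Icc (zero_le_one' ℝ) hG
  have h0 : (0 : ℝ) ∈ Icc (f (u + 0 * h, v) - f (u + (1 - 0) * h, v'))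
      (f (u + 1 * h, v) - f (u + (1 - 1) * h, v')) := by
    simp only [zero_mul, add_zero, sub_zero, one_mul, sub_self]
    constructor <;> nlinarith
  obtain ⟨t, ht, e⟩ := hI h0
  refine ⟨u + t * h, ⟨?_, ?_⟩, u + (1 - t) * h, ⟨?_, ?_⟩, by simpa [sub_eq_zero] using e⟩
  all_goals nlinarith [ht.1, ht.2, mul_nonneg ht.1 hh, mul_nonneg (sub_nonneg.2 ht.2) hh]

open Set in
lemma gap_any (f : ℝ × ℝ → ℝ) (hf : Differentiable ℝ f) (u h v v' : ℝ) (hh : 0 ≤ h)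
    (hv : v ≤ v')
    (sx : (∀ q ∈ Icc u (u + h) ×ˢ Icc v v', 0 < pdx f q) ∨
      (∀ q ∈ Icc u (u + h) ×ˢ Icc v v', pdx f q < 0))
    (H : ∀ q ∈ Icc u (u + h) ×ˢ Icc v v', |pdy f q| * (v' - v) ≤ |pdx f q| * h) :
    ∃ s ∈ Icc u (u + h), ∃ t ∈ Icc u (u + h), f (s, v) = f (t, v') := by
  rcases sx with sx | sx
  · exact gap_pos f hf u h v v' hh hv (fun q hq => by
      have := H q hq
      rwa [abs_of_pos (sx q hq)] at this)
  · obtain ⟨s, hs, t, ht, e⟩ := gap_pos (-f) hf.neg u h v v' hh hv (fun q hq => by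
      have := H q hq
      rw [abs_of_neg (sx q hq)] at this
      rwa [pdx_neg, pdy_neg, abs_neg])
    exact ⟨s, hs, t, ht, by simpa using e⟩

open Set in
lemma strip (f : ℝ × ℝ → ℝ) (hf : Differentiable ℝ f) (N : ℕ) (hN : 1 ≤ N)
    (u h b l m r : ℝ) (B : ℕ → ℝ) (hh : 0 ≤ h) (hm : 0 ≤ m)
    (B0 : B 0 = b) (B1 : B (N - 1) + m = b + l)
    (Bin : ∀ i < N, b ≤ B i ∧ B i + m ≤ b + l)
    (Bgap : ∀ i, i + 1 < N → B i ≤ B (i + 1) ∧ B (i + 1) - (B i + m) ≤ r)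
    (sx : (∀ q ∈ Icc u (u + h) ×ˢ Icc b (b + l), 0 < pdx f q) ∨
      (∀ q ∈ Icc u (u + h) ×ˢ Icc b (b + l), pdx f q < 0))
    (sy : (∀ q ∈ Icc u (u + h) ×ˢ Icc b (b + l), 0 < pdy f q) ∨
      (∀ q ∈ Icc u (u + h) ×ˢ Icc b (b + l), pdy f q < 0))
    (H : ∀ q ∈ Icc u (u + h) ×ˢ Icc b (b + l), |pdy f q| * r ≤ |pdx f q| * h) :
    ∀ q ∈ Icc u (u + h) ×ˢ Icc b (b + l),
      ∃ j < N, ∃ q' ∈ Icc u (u + h) ×ˢ Icc (B j) (B j + m), f q' = f q := by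
  have hc := hf.continuous
  have hU : IsPreconnected (⋃ j ∈ Iio N, f '' (Icc u (u + h) ×ˢ Icc (B j) (B j + m))) := by
    apply IsPreconnected.biUnion_of_chain ordConnected_Iio
    · intro j _
      exact (isPreconnected_Icc.prod isPreconnected_Icc).image _ hc.continuousOn
    · intro j hj hj1
      simp only [Order.succ_eq_add_one, mem_Iio] at hj hj1 ⊢
      obtain ⟨g1, g2⟩ := Bgap j hj1
      have n0 := Bin j hj
      have n1 := Bin (j + 1) hj1
      by_cases hcase : B (j + 1) ≤ B j + m
      · refine ⟨f (u, B (j + 1)), ⟨_, ⟨⟨le_rfl, by simpa using hh⟩, ⟨g1, hcase⟩⟩, rfl⟩,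
          ⟨_, ⟨⟨le_rfl, by simpa using hh⟩, ⟨le_rfl, by simpa using hm⟩⟩, rfl⟩⟩
      · push Not at hcase
        have hsub : Icc u (u + h) ×ˢ Icc (B j + m) (B (j + 1)) ⊆
            Icc u (u + h) ×ˢ Icc b (b + l) :=
          prod_mono le_rfl (Icc_subset_Icc (by linarith) (by linarith))
        obtain ⟨s, hs, t, ht, e⟩ := gap_any f hf u h (B j + m) (B (j + 1)) hh hcase.le
          (sx.imp (fun k q hq => k q (hsub hq)) (fun k q hq => k q (hsub hq)))
          (fun q hq => (mul_le_mul_of_nonneg_left g2 (abs_nonneg _)).trans (H q (hsub hq)))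
        exact ⟨_, ⟨_, ⟨hs, ⟨by simpa using hm, le_rfl⟩⟩, rfl⟩,
          ⟨_, ⟨ht, ⟨le_rfl, by simpa using hm⟩⟩, e.symm⟩⟩
  rintro ⟨x, y⟩ ⟨hx, hy⟩
  simp only at hx hy
  have hO := hU.ordConnected
  have i1 : f (x, b) ∈ (⋃ j ∈ Iio N, f '' (Icc u (u + h) ×ˢ Icc (B j) (B j + m))) := by
    simp only [mem_iUnion]
    exact ⟨0, by simp only [mem_Iio]; omega, ⟨(x, b), ⟨hx, by simp [B0, hm]⟩, rfl⟩⟩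
  have i2 : f (x, b + l) ∈ (⋃ j ∈ Iio N, f '' (Icc u (u + h) ×ˢ Icc (B j) (B j + m))) := by
    simp only [mem_iUnion]
    exact ⟨N - 1, by simp; omega, ⟨(x, b + l), ⟨hx, by simp [← B1, hm]⟩, rfl⟩⟩
  have hbl : b ≤ b + l := hy.1.trans hy.2
  have hconv : Convex ℝ (Icc u (u + h) ×ˢ Icc b (b + l)) :=
    (convex_Icc _ _).prod (convex_Icc _ _)
  obtain ⟨z1, hz1, e1⟩ := mvt_rect f hf _ hconv (x, b) (x, y) ⟨hx, ⟨le_rfl, hbl⟩⟩ ⟨hx, hy⟩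
  obtain ⟨z2, hz2, e2⟩ := mvt_rect f hf _ hconv (x, y) (x, b + l) ⟨hx, hy⟩ ⟨hx, ⟨hbl, le_rfl⟩⟩
  simp only [sub_self, zero_mul, zero_add] at e1 e2
  have hmem : f (x, y) ∈ (⋃ j ∈ Iio N, f '' (Icc u (u + h) ×ˢ Icc (B j) (B j + m))) := by
    rcases sy with sy | sy
    · apply hO.out i1 i2
      have := mul_nonneg (sub_nonneg.2 hy.1) (sy z1 hz1).le
      have := mul_nonneg (sub_nonneg.2 hy.2) (sy z2 hz2).le
      constructor <;> linarith
    · apply hO.out i2 i1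
      have := mul_nonpos_of_nonneg_of_nonpos (sub_nonneg.2 hy.1) (sy z1 hz1).le
      have := mul_nonpos_of_nonneg_of_nonpos (sub_nonneg.2 hy.2) (sy z2 hz2).le
      constructor <;> linarith
  simp only [mem_iUnion] at hmem
  obtain ⟨j, hj, q', hq', e⟩ := hmem
  exact ⟨j, hj, q', hq', e⟩

open Set in
lemma moran_step (f : ℝ × ℝ → ℝ) (hf : Differentiable ℝ f) (N : ℕ) (hN : 1 ≤ N)
    (a b l m r : ℝ) (A B : ℕ → ℝ) (hl : 0 ≤ l) (hm : 0 ≤ m)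
    (A0 : A 0 = a) (A1 : A (N - 1) + m = a + l)
    (Ain : ∀ i < N, a ≤ A i ∧ A i + m ≤ a + l)
    (Agap : ∀ i, i + 1 < N → A i ≤ A (i + 1) ∧ A (i + 1) - (A i + m) ≤ r)
    (B0 : B 0 = b) (B1 : B (N - 1) + m = b + l)
    (Bin : ∀ i < N, b ≤ B i ∧ B i + m ≤ b + l)
    (Bgap : ∀ i, i + 1 < N → B i ≤ B (i + 1) ∧ B (i + 1) - (B i + m) ≤ r)
    (sx : (∀ q ∈ Icc a (a + l) ×ˢ Icc b (b + l), 0 < pdx f q) ∨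
      (∀ q ∈ Icc a (a + l) ×ˢ Icc b (b + l), pdx f q < 0))
    (sy : (∀ q ∈ Icc a (a + l) ×ˢ Icc b (b + l), 0 < pdy f q) ∨
      (∀ q ∈ Icc a (a + l) ×ˢ Icc b (b + l), pdy f q < 0))
    (H1 : ∀ q ∈ Icc a (a + l) ×ˢ Icc b (b + l), |pdy f q| * r ≤ |pdx f q| * m)
    (H2 : ∀ q ∈ Icc a (a + l) ×ˢ Icc b (b + l), |pdx f q| * r ≤ |pdy f q| * l) :
    ∀ q ∈ Icc a (a + l) ×ˢ Icc b (b + l),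
      ∃ i < N, ∃ j < N, ∃ q' ∈ Icc (A i) (A i + m) ×ˢ Icc (B j) (B j + m), f q' = f q := by
  intro q hq
  have hsw : ∀ q ∈ Icc b (b + l) ×ˢ Icc a (a + l),
      Prod.swap q ∈ Icc a (a + l) ×ˢ Icc b (b + l) := fun q hq => ⟨hq.2, hq.1⟩
  have hdf : Differentiable ℝ (f ∘ Prod.swap) :=
    hf.comp (ContinuousLinearEquiv.prodComm ℝ ℝ ℝ).differentiable
  obtain ⟨i, hi, q1, hq1, e1⟩ := strip (f ∘ Prod.swap) hdf N hN b l a l m r A hl hm A0 A1 Ain Agap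
    (sy.imp (fun k q hq => by rw [pdx_swap f hf]; exact k _ (hsw q hq))
      (fun k q hq => by rw [pdx_swap f hf]; exact k _ (hsw q hq)))
    (sx.imp (fun k q hq => by rw [pdy_swap f hf]; exact k _ (hsw q hq))
      (fun k q hq => by rw [pdy_swap f hf]; exact k _ (hsw q hq)))
    (fun q hq => by rw [pdy_swap f hf, pdx_swap f hf]; exact H2 _ (hsw q hq)) q.swap
    ⟨hq.2, hq.1⟩
  have hsub : Icc (A i) (A i + m) ×ˢ Icc b (b + l) ⊆ Icc a (a + l) ×ˢ Icc b (b + l) :=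
    prod_mono (Icc_subset_Icc (Ain i hi).1 (Ain i hi).2) le_rfl
  obtain ⟨j, hj, q2, hq2, e2⟩ := strip f hf N hN (A i) m b l m r B hm hm B0 B1 Bin Bgap
    (sx.imp (fun k q hq => k q (hsub hq)) (fun k q hq => k q (hsub hq)))
    (sy.imp (fun k q hq => k q (hsub hq)) (fun k q hq => k q (hsub hq)))
    (fun q hq => H1 q (hsub hq)) q1.swap ⟨hq1.2, hq1.1⟩
  refine ⟨i, hi, j, hj, q2, hq2, ?_⟩
  rw [e2]
  simpa using e1

lemma moranLen_pos (c : ℕ → ℝ) (hc : ∀ k ≥ 1, 0 < c k ∧ c k < 1 / 2) (k : ℕ) :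
    0 < moranLen c k :=
  Finset.prod_pos fun j _ => (hc (j + 1) (by omega)).1

lemma moranLen_succ (c : ℕ → ℝ) (k : ℕ) :
    moranLen c (k + 1) = moranLen c k * c (k + 1) := Finset.prod_range_succ _ _

lemma moranAdm_append (n : ℕ → ℕ) (w : List ℕ) (i : ℕ) :
    MoranAdm n (w ++ [i]) ↔ MoranAdm n w ∧ i < n (w.length + 1) := by
  unfold MoranAdm
  constructor
  · intro h
    refine ⟨fun j hj => ?_, ?_⟩
    · have := h j (by simp; omega)
      rwa [List.getD_append _ _ _ _ hj] at this
    · have := h w.length (by simp)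
      rwa [List.getD_append_right _ _ _ _ le_rfl, Nat.sub_self] at this
  · rintro ⟨h1, h2⟩ j hj
    rcases Nat.lt_or_ge j w.length with h | h
    · rw [List.getD_append _ _ _ _ h]; exact h1 j h
    · have : j = w.length := by simp at hj; omega
      subst this
      rw [List.getD_append_right _ _ _ _ le_rfl, Nat.sub_self]; exact h2

lemma moran_words (n : ℕ → ℕ) (k : ℕ) (w : List ℕ) (hw : MoranAdm n w) (hl : w.length = k + 1) :
    ∃ v i, w = v ++ [i] ∧ MoranAdm n v ∧ v.length = k ∧ i < n (k + 1) := by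
  rcases List.eq_nil_or_concat' w with h | ⟨v, i, h⟩
  · subst h; simp at hl
  · subst h
    have hv : v.length = k := by simpa using hl
    obtain ⟨h1, h2⟩ := (moranAdm_append n v i).1 hw
    exact ⟨v, i, rfl, h1, hv, hv ▸ h2⟩

lemma moran_words_finite (n : ℕ → ℕ) (k : ℕ) :
    {w : List ℕ | MoranAdm n w ∧ w.length = k}.Finite := by
  induction k with
  | zero =>
    apply (Set.finite_singleton ([] : List ℕ)).subset
    rintro w ⟨_, h⟩
    exact List.length_eq_zero_iff.1 h
  | succ k ih =>
    apply ((ih.prod (Set.finite_Iio (n (k + 1)))).image (fun x => x.1 ++ [x.2])).subset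
    rintro w ⟨h1, h2⟩
    obtain ⟨v, i, rfl, h3, h4, h5⟩ := moran_words n k w h1 h2
    exact ⟨(v, i), ⟨⟨h3, h4⟩, h5⟩, rfl⟩

lemma moran_compact (c : ℕ → ℝ) (n : ℕ → ℕ) (L : List ℕ → ℝ) (k : ℕ) :
    IsCompact (moranLevel c n L k) :=
  (moran_words_finite n k).isCompact_biUnion fun _ _ => isCompact_Icc

lemma moran_child (c : ℕ → ℝ) (n : ℕ → ℕ) (κ : ℝ) (hc : ∀ k ≥ 1, 0 < c k ∧ c k < 1 / 2)
    (L : List ℕ → ℝ) (E : Set ℝ)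
    (hE : IsMoran c n κ L E) (w : List ℕ) (hw : MoranAdm n w) (i : ℕ)
    (hi : i < n (w.length + 1)) :
    L w ≤ L (w ++ [i]) ∧
      L (w ++ [i]) + moranLen c (w.length + 1) ≤ L w + moranLen c w.length := by
  have hpos := moranLen_pos c hc (w.length + 1)
  have hs := (hE.2.1 w hw).2.2.2.subset
  have hmem : ∀ x ∈ Set.Icc (L (w ++ [i])) (L (w ++ [i]) + moranLen c (w.length + 1)),
      x ∈ Set.Icc (L w) (L w + moranLen c w.length) := fun x hx => hs (by
    simp only [Set.mem_iUnion]
    exact ⟨i, by simpa using hi, hx⟩)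
  exact ⟨(hmem _ ⟨le_rfl, by linarith⟩).1, (hmem _ ⟨by linarith, le_rfl⟩).2⟩

lemma moran_anti (c : ℕ → ℝ) (n : ℕ → ℕ) (κ : ℝ) (hc : ∀ k ≥ 1, 0 < c k ∧ c k < 1 / 2)
    (L : List ℕ → ℝ) (E : Set ℝ) (hE : IsMoran c n κ L E) (k : ℕ) :
    moranLevel c n L (k + 1) ⊆ moranLevel c n L k := by
  intro x hx
  simp only [moranLevel, Set.mem_iUnion] at hx ⊢
  obtain ⟨w, ⟨hw, hl⟩, hx⟩ := hx
  obtain ⟨v, i, rfl, h1, h2, h3⟩ := moran_words n k w hw hl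
  subst h2
  obtain ⟨g1, g2⟩ := moran_child c n κ hc L E hE v h1 i h3
  exact ⟨v, ⟨h1, rfl⟩, ⟨g1.trans hx.1, hx.2.trans g2⟩⟩

lemma moran_gap (c : ℕ → ℝ) (n : ℕ → ℕ) (κ : ℝ) (hn : ∀ k ≥ 1, 2 ≤ n k)
    (L : List ℕ → ℝ) (E : Set ℝ)
    (hE : IsMoran c n κ L E) (w : List ℕ) (hw : MoranAdm n w) (i : ℕ)
    (hi : i + 1 < n (w.length + 1)) :
    L (w ++ [i]) ≤ L (w ++ [i + 1]) ∧
      L (w ++ [i + 1]) - (L (w ++ [i]) + moranLen c (w.length + 1)) ≤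
        (1 - xiM c n κ (w.length + 1)) * moranLen c w.length := by
  obtain ⟨h1, h2, h3, -⟩ := hE.2.1 w hw
  refine ⟨(h1 i (i + 1) (by omega) hi).1, ?_⟩
  set m := moranLen c (w.length + 1) with hm
  set N := n (w.length + 1) with hN
  have hmul : m = moranLen c w.length * c (w.length + 1) := moranLen_succ c _
  have gen : ∀ d i : ℕ, i + d < N → (d : ℝ) * ((1 - κ) * m) ≤ L (w ++ [i + d]) - L (w ++ [i]) := by
    intro d
    induction d with
    | zero => intro i _; simp
    | succ d ih =>
      intro i hid
      have a1 := ih i (by omega)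
      have a2 := (h1 (i + d) (i + (d + 1)) (by omega) hid).2
      push_cast
      linarith
  have g1 := gen i 0 (by omega)
  rw [zero_add, h2] at g1
  have g2 := gen (N - 2 - i) (i + 1) (by omega)
  rw [show i + 1 + (N - 2 - i) = N - 1 by omega] at g2
  have hcast : ((N - 2 - i : ℕ) : ℝ) = (N : ℝ) - 2 - i := by
    rw [Nat.sub_sub, Nat.cast_sub (by omega)]; push_cast; ring
  rw [hcast] at g2
  have hx : xiM c n κ (w.length + 1) * moranLen c w.length =
      2 * m + ((N : ℝ) - 2) * ((1 - κ) * m) := by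
    rw [hmul, xiM]; ring
  rw [sub_mul, hx]
  linarith

open Set in
lemma moran_main (c : ℕ → ℝ) (n : ℕ → ℕ) (κ : ℝ)
    (hc : ∀ k ≥ 1, 0 < c k ∧ c k < 1 / 2) (hn : ∀ k ≥ 1, 2 ≤ n k)
    (L₁ L₂ : List ℕ → ℝ) (E₁ E₂ : Set ℝ)
    (hE₁ : IsMoran c n κ L₁ E₁) (hE₂ : IsMoran c n κ L₂ E₂)
    (f : ℝ × ℝ → ℝ) (hf : Differentiable ℝ f) (p : ℕ)
    (sx : (∀ q ∈ moranLevel c n L₁ p ×ˢ moranLevel c n L₂ p, 0 < pdx f q) ∨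
      (∀ q ∈ moranLevel c n L₁ p ×ˢ moranLevel c n L₂ p, pdx f q < 0))
    (sy : (∀ q ∈ moranLevel c n L₁ p ×ˢ moranLevel c n L₂ p, 0 < pdy f q) ∨
      (∀ q ∈ moranLevel c n L₁ p ×ˢ moranLevel c n L₂ p, pdy f q < 0))
    (H : ∀ q ∈ moranLevel c n L₁ p ×ˢ moranLevel c n L₂ p, ∀ k ≥ p, 1 ≤ k →
      |pdy f q| * (1 - xiM c n κ k) ≤ |pdx f q| * c k ∧
      |pdx f q| * (1 - xiM c n κ k) ≤ |pdy f q|) :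
    ∃ s : Finset (ℝ × ℝ), f '' (E₁ ×ˢ E₂) = ⋃ q ∈ s, Set.Icc q.1 q.2 := by
  have hcont := hf.continuous
  have anti₁ : Antitone (moranLevel c n L₁) :=
    antitone_nat_of_succ_le (moran_anti c n κ hc L₁ E₁ hE₁)
  have anti₂ : Antitone (moranLevel c n L₂) :=
    antitone_nat_of_succ_le (moran_anti c n κ hc L₂ E₂ hE₂)
  -- one refinement step
  have step : ∀ k ≥ p, ∀ q ∈ moranLevel c n L₁ k ×ˢ moranLevel c n L₂ k,
      ∃ q' ∈ moranLevel c n L₁ (k + 1) ×ˢ moranLevel c n L₂ (k + 1), f q' = f q := by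
    intro k hk q hq
    obtain ⟨hq1, hq2⟩ := hq
    simp only [moranLevel, mem_iUnion] at hq1 hq2
    obtain ⟨v, ⟨hv, hvl⟩, hq1⟩ := hq1
    obtain ⟨w, ⟨hw, hwl⟩, hq2⟩ := hq2
    have hsub : Icc (L₁ v) (L₁ v + moranLen c k) ×ˢ Icc (L₂ w) (L₂ w + moranLen c k) ⊆
        moranLevel c n L₁ p ×ˢ moranLevel c n L₂ p := by
      refine prod_mono (Subset.trans ?_ (anti₁ hk)) (Subset.trans ?_ (anti₂ hk))
      · exact subset_biUnion_of_mem (u := fun w => Icc (L₁ w) (L₁ w + moranLen c k))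
          (show v ∈ {w : List ℕ | MoranAdm n w ∧ w.length = k} from ⟨hv, hvl⟩)
      · exact subset_biUnion_of_mem (u := fun w => Icc (L₂ w) (L₂ w + moranLen c k))
          (show w ∈ {w : List ℕ | MoranAdm n w ∧ w.length = k} from ⟨hw, hwl⟩)
    have hlpos := moranLen_pos c hc k
    have hN : 2 ≤ n (k + 1) := hn (k + 1) (by omega)
    have a1 := hE₁.2.1 v hv
    have a2 := hE₂.2.1 w hw
    have b1 := moran_child c n κ hc L₁ E₁ hE₁ v hv
    have b2 := moran_child c n κ hc L₂ E₂ hE₂ w hw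
    have d1 := moran_gap c n κ hn L₁ E₁ hE₁ v hv
    have d2 := moran_gap c n κ hn L₂ E₂ hE₂ w hw
    rw [hvl] at a1 b1 d1
    rw [hwl] at a2 b2 d2
    obtain ⟨i, hi, j, hj, q', hq', e⟩ := moran_step f hf (n (k + 1)) (by omega) (L₁ v) (L₂ w)
      (moranLen c k) (moranLen c (k + 1)) ((1 - xiM c n κ (k + 1)) * moranLen c k)
      (fun i => L₁ (v ++ [i])) (fun i => L₂ (w ++ [i])) hlpos.le (moranLen_pos c hc _).le
      a1.2.1 a1.2.2.1 b1 d1 a2.2.1 a2.2.2.1 b2 d2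
      (sx.imp (fun k q hq => k q (hsub hq)) (fun k q hq => k q (hsub hq)))
      (sy.imp (fun k q hq => k q (hsub hq)) (fun k q hq => k q (hsub hq)))
      (fun q hq => by
        have := mul_le_mul_of_nonneg_right (H q (hsub hq) (k + 1) (by omega) (by omega)).1 hlpos.le
        rw [moranLen_succ]
        linarith)
      (fun q hq => by
        have := mul_le_mul_of_nonneg_right (H q (hsub hq) (k + 1) (by omega) (by omega)).2 hlpos.le
        linarith) q ⟨hq1, hq2⟩
    refine ⟨q', ⟨?_, ?_⟩, e⟩
    · simp only [moranLevel, mem_iUnion]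
      exact ⟨v ++ [i], ⟨(moranAdm_append n v i).2 ⟨hv, hvl ▸ hi⟩, by simp [hvl]⟩, hq'.1⟩
    · simp only [moranLevel, mem_iUnion]
      exact ⟨w ++ [j], ⟨(moranAdm_append n w j).2 ⟨hw, hwl ▸ hj⟩, by simp [hwl]⟩, hq'.2⟩
  have steps : ∀ d, ∀ q ∈ moranLevel c n L₁ p ×ˢ moranLevel c n L₂ p,
      ∃ q' ∈ moranLevel c n L₁ (p + d) ×ˢ moranLevel c n L₂ (p + d), f q' = f q := by
    intro d
    induction d with
    | zero => exact fun q hq => ⟨q, hq, rfl⟩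
    | succ d ih =>
      intro q hq
      obtain ⟨q1, h1, e1⟩ := ih q hq
      obtain ⟨q2, h2, e2⟩ := step (p + d) (by omega) q1 h1
      exact ⟨q2, h2, e2.trans e1⟩
  -- compactness
  have himg : f '' (E₁ ×ˢ E₂) = f '' (moranLevel c n L₁ p ×ˢ moranLevel c n L₂ p) := by
    apply Subset.antisymm
    · apply image_mono
      rw [hE₁.2.2, hE₂.2.2]
      exact prod_mono (iInter_subset _ p) (iInter_subset _ p)
    · rintro _ ⟨q, hq, rfl⟩
      have hcpt : ∀ k, IsCompact (moranLevel c n L₁ k ×ˢ moranLevel c n L₂ k ∩ f ⁻¹' {f q}) :=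
        fun k => ((moran_compact c n L₁ k).prod (moran_compact c n L₂ k)).inter_right
          (isClosed_singleton.preimage hcont)
      obtain ⟨z, hz⟩ := IsCompact.nonempty_iInter_of_sequence_nonempty_isCompact_isClosed
        (fun k => moranLevel c n L₁ k ×ˢ moranLevel c n L₂ k ∩ f ⁻¹' {f q})
        (fun k => inter_subset_inter_left _ (prod_mono (anti₁ k.le_succ) (anti₂ k.le_succ)))
        (fun k => by
          obtain ⟨q', h', e'⟩ := steps k q hq
          exact ⟨q', prod_mono (anti₁ (by omega)) (anti₂ (by omega)) h', e'⟩)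
        (hcpt 0) (fun k => (hcpt k).isClosed)
      rw [mem_iInter] at hz
      refine ⟨z, ⟨?_, ?_⟩, (hz 0).2⟩
      · rw [hE₁.2.2, mem_iInter]; exact fun k => (hz k).1.1
      · rw [hE₂.2.2, mem_iInter]; exact fun k => (hz k).1.2
  rw [himg]
  -- finitely many intervals
  have hW := moran_words_finite n p
  have hl := moranLen_pos c hc p
  have hI : ∀ x : List ℕ × List ℕ, ∃ r : ℝ × ℝ,
      f '' (Icc (L₁ x.1) (L₁ x.1 + moranLen c p) ×ˢ Icc (L₂ x.2) (L₂ x.2 + moranLen c p)) =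
        Icc r.1 r.2 := by
    intro x
    have hcon : IsConnected
        (Icc (L₁ x.1) (L₁ x.1 + moranLen c p) ×ˢ Icc (L₂ x.2) (L₂ x.2 + moranLen c p)) :=
      (isConnected_Icc (by linarith)).prod (isConnected_Icc (by linarith))
    exact ⟨(_, _), eq_Icc_of_connected_compact (hcon.image _ hcont.continuousOn)
      ((isCompact_Icc.prod isCompact_Icc).image hcont)⟩
  choose r hr using hI
  classical
  refine ⟨(hW.prod hW).toFinset.image r, ?_⟩
  ext y
  simp only [mem_image, mem_iUnion, Finset.mem_image, Finite.mem_toFinset, moranLevel]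
  constructor
  · rintro ⟨q, ⟨h1, h2⟩, rfl⟩
    simp only [mem_iUnion] at h1 h2
    obtain ⟨v, hv, h1⟩ := h1
    obtain ⟨w, hw, h2⟩ := h2
    refine ⟨r (v, w), ⟨(v, w), ⟨hv, hw⟩, rfl⟩, ?_⟩
    rw [← hr]
    exact ⟨q, ⟨h1, h2⟩, rfl⟩
  · rintro ⟨_, ⟨⟨v, w⟩, ⟨hv, hw⟩, rfl⟩, hy⟩
    rw [← hr] at hy
    obtain ⟨q, ⟨h1, h2⟩, rfl⟩ := hy
    refine ⟨q, ⟨?_, ?_⟩, rfl⟩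
    · simp only [mem_iUnion]; exact ⟨v, hv, h1⟩
    · simp only [mem_iUnion]; exact ⟨w, hw, h2⟩

theorem stmt_5 (c : ℕ → ℝ) (n : ℕ → ℕ) (κ : ℝ)
    (hc : ∀ k ≥ 1, 0 < c k ∧ c k < 1 / 2) (hn : ∀ k ≥ 1, 2 ≤ n k)
    (hcn : ∀ k ≥ 1, c k * n k < 1) (hκ0 : 0 ≤ κ) (hκ1 : κ < 1)
    (L₁ L₂ : List ℕ → ℝ) (E₁ E₂ : Set ℝ)
    (hE₁ : IsMoran c n κ L₁ E₁) (hE₂ : IsMoran c n κ L₂ E₂)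
    (f : ℝ × ℝ → ℝ) (hf : ContDiff ℝ 3 f) (p : ℕ) (hp : 1 ≤ p) (δ : ℝ)
    (hsign : SignCond f (moranLevel c n L₁ p ×ˢ moranLevel c n L₂ p) δ)
    (hQ1 : ∀ q ∈ moranLevel c n L₁ p ×ˢ moranLevel c n L₂ p, ∀ k ≥ p,
      0 ≤ quadOp (c k) (δ * (xiM c n κ k - 1)) f q)
    (hQ2 : ∀ q ∈ moranLevel c n L₁ p ×ˢ moranLevel c n L₂ p, ∀ k ≥ p,
      0 ≤ quadOp (δ * (xiM c n κ k - 1)) 1 f q)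
    (hratio : ∀ q ∈ moranLevel c n L₁ p ×ˢ moranLevel c n L₂ p, ∀ k ≥ p,
      1 - xiM c n κ k ≤ δ * (pdy f q / pdx f q) ∧
      δ * (pdy f q / pdx f q) ≤ c k / (1 - xiM c n κ k)) :
    ∃ s : Finset (ℝ × ℝ), f '' (E₁ ×ˢ E₂) = ⋃ q ∈ s, Set.Icc q.1 q.2 := by
  have hxi : ∀ k ≥ 1, 0 < 1 - xiM c n κ k := by
    intro k hk
    have h1 := hc k hk
    have h2 : (2 : ℝ) ≤ n k := by exact_mod_cast hn k hk
    have h3 := hcn k hk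
    have h4 : 0 ≤ c k * (((n k : ℝ) - 2) * κ) :=
      mul_nonneg h1.1.le (mul_nonneg (by linarith) hκ0)
    unfold xiM
    nlinarith
  have hfin : ∀ q ∈ moranLevel c n L₁ p ×ˢ moranLevel c n L₂ p,
      pdx f q ≠ 0 ∧ δ * (pdy f q / pdx f q) = |pdy f q| / |pdx f q| := by
    intro q hq
    rcases hsign with ⟨rfl, h | h⟩ | ⟨rfl, h | h⟩
    · obtain ⟨h1, h2⟩ := h q hq
      exact ⟨h1.ne', by rw [abs_of_pos h1, abs_of_pos h2, one_mul]⟩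
    · obtain ⟨h1, h2⟩ := h q hq
      exact ⟨h1.ne, by rw [abs_of_neg h1, abs_of_neg h2, one_mul, neg_div_neg_eq]⟩
    · obtain ⟨h1, h2⟩ := h q hq
      exact ⟨h1.ne, by rw [abs_of_neg h1, abs_of_pos h2, div_neg, neg_one_mul]⟩
    · obtain ⟨h1, h2⟩ := h q hq
      exact ⟨h1.ne', by rw [abs_of_pos h1, abs_of_neg h2, neg_div, neg_one_mul]⟩
  refine moran_main c n κ hc hn L₁ L₂ E₁ E₂ hE₁ hE₂ f (hf.differentiable (by norm_num)) p
    ?_ ?_ ?_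
  · rcases hsign with ⟨-, h | h⟩ | ⟨-, h | h⟩
    · exact Or.inl fun q hq => (h q hq).1
    · exact Or.inr fun q hq => (h q hq).1
    · exact Or.inr fun q hq => (h q hq).1
    · exact Or.inl fun q hq => (h q hq).1
  · rcases hsign with ⟨-, h | h⟩ | ⟨-, h | h⟩
    · exact Or.inl fun q hq => (h q hq).2
    · exact Or.inr fun q hq => (h q hq).2
    · exact Or.inl fun q hq => (h q hq).2
    · exact Or.inr fun q hq => (h q hq).2
  · intro q hq k hk hk1
    obtain ⟨hne, he⟩ := hfin q hq
    have hpos : 0 < |pdx f q| := abs_pos.2 hne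
    obtain ⟨h1, h2⟩ := hratio q hq k hk
    rw [he] at h1 h2
    have hx := hxi k hk1
    rw [le_div_iff₀ hpos] at h1
    rw [div_le_div_iff₀ hpos hx] at h2
    constructor <;> linarith
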